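/- Let φ : ℝ → ℂ be a bounded measurable function satisfying φ(q + √2 m) = e^{2πiαm} φ(q) for almost every q ∈ ℝ and every m ∈ ℤ. Then for every z ∈ ℂ, (Bφ)(z) = ∫_0^{√2} A(z;q) φ(q) dq, where A(z;q) = (ν/π)^{3/4} e^{(ν/2)z² − ν(q/√2 − z)²} θ₃( (iν/π)(q/√2 − z) + α | iν/π ). -/

import Mathlib

open Complex MeasureTheory

/-- The Jacobi theta function `θ₃(ξ|τ) = Σ_{n∈ℤ} e^{πin²τ + 2πinξ}`. -/
noncomputable def jacobiTheta3 (ξ τ : ℂ) : ℂ :=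
  ∑' n : ℤ, Complex.exp (Real.pi * Complex.I * (n : ℂ) ^ 2 * τ +
    2 * Real.pi * Complex.I * (n : ℂ) * ξ)

/-- The kernel
`A(z;q) = (ν/π)^{3/4} e^{(ν/2)z² − ν(q/√2 − z)²} θ₃((iν/π)(q/√2 − z) + α | iν/π)`. -/
noncomputable def bargmannKernel (α ν : ℝ) (z : ℂ) (q : ℝ) : ℂ :=
  (((ν / Real.pi) ^ ((3 : ℝ) / 4) : ℝ) : ℂ) *
    Complex.exp (ν / 2 * z ^ 2 - ν * ((q : ℂ) / Real.sqrt 2 - z) ^ 2) *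
    jacobiTheta3
      (Complex.I * ν / Real.pi * ((q : ℂ) / Real.sqrt 2 - z) + α)
      (Complex.I * ν / Real.pi)

/-- Folding an integrable function over the translates of one period. -/
theorem integral_eq_setIntegral_tsum_add_mul_int {F : ℝ → ℂ} (hF : Integrable F)
    {p : ℝ} (hp : 0 < p) :
    ∫ q, F q = ∫ q in Set.Ioc 0 p, ∑' n : ℤ, F (q + p * n) := by
  have hmeas (n : ℤ) : MeasurableSet (Set.Ioc (n • p) ((n + 1) • p)) := measurableSet_Ioc
  have hdisj : Pairwise (Function.onFun Disjoint fun n : ℤ ↦ Set.Ioc (n • p) ((n + 1) • p)) :=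
    Set.pairwise_disjoint_Ioc_zsmul p
  have hshift {E : Type} [NormedAddCommGroup E] [NormedSpace ℝ E] (G : ℝ → E) (n : ℤ) :
      ∫ q in Set.Ioc (n • p) ((n + 1) • p), G q = ∫ q in Set.Ioc 0 p, G (q + p * n) := by
    have hle : n • p ≤ (n + 1) • p := by rw [add_smul, one_smul]; linarith
    rw [← intervalIntegral.integral_of_le hle, ← intervalIntegral.integral_of_le hp.le,
      intervalIntegral.integral_comp_add_right]
    congr 1 <;> simp <;> ring
  have hfold {E : Type} [NormedAddCommGroup E] [NormedSpace ℝ E] {G : ℝ → E}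
      (hG : Integrable G) :
      HasSum (fun n : ℤ ↦ ∫ q in Set.Ioc 0 p, G (q + p * n)) (∫ q, G q) := by
    have h := hasSum_integral_iUnion hmeas hdisj hG.integrableOn
    simpa only [iUnion_Ioc_zsmul hp, setIntegral_univ, hshift G] using h
  rw [← (hfold hF).tsum_eq]
  exact integral_tsum_of_summable_integral_norm
    (fun n ↦ (hF.comp_add_right (p * n)).integrableOn) (hfold hF.norm).summable

/-- The product of a bounded measurable function with the Bargmann kernel is integrable. -/
theorem integrable_mul_bargmann_exp {ν : ℝ} (hν : 0 < ν) {φ : ℝ → ℂ} (hmeas : Measurable φ)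
    {C : ℝ} (hC : ∀ q, ‖φ q‖ ≤ C) (z : ℂ) :
    Integrable fun q : ℝ ↦ φ q * Complex.exp (-(ν / 2) * (z ^ 2 + (q : ℂ) ^ 2) +
      ν * Real.sqrt 2 * z * q) := by
  have hgauss : Integrable fun q : ℝ ↦ Complex.exp (-(ν / 2) * (z ^ 2 + (q : ℂ) ^ 2) +
      ν * Real.sqrt 2 * z * q) := by
    have hre : (-(ν / 2 : ℂ)).re < 0 := by
      have : (-(ν / 2 : ℂ)) = ((-(ν / 2) : ℝ) : ℂ) := by push_cast; rfl
      rw [this, ofReal_re]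
      linarith
    refine (integrable_cexp_quadratic' hre (ν * Real.sqrt 2 * z) (-(ν / 2) * z ^ 2)).congr
      (.of_forall fun q ↦ ?_)
    simp only
    ring_nf
  exact hgauss.bdd_mul hmeas.aestronglyMeasurable (.of_forall hC)

/-- Translating the Gaussian exponent by `√2 n` produces the `n`-th term of `θ₃`. -/
theorem bargmann_exp_add_sqrt_two_mul (α ν : ℝ) (z : ℂ) (q : ℝ) (n : ℤ) :
    Complex.exp (2 * Real.pi * Complex.I * α * n) *
        Complex.exp (-(ν / 2) * (z ^ 2 + ((q + Real.sqrt 2 * n : ℝ) : ℂ) ^ 2) +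
          ν * Real.sqrt 2 * z * ((q + Real.sqrt 2 * n : ℝ) : ℂ)) =
      Complex.exp (ν / 2 * z ^ 2 - ν * ((q : ℂ) / Real.sqrt 2 - z) ^ 2) *
        Complex.exp (Real.pi * Complex.I * (n : ℂ) ^ 2 * (Complex.I * ν / Real.pi) +
          2 * Real.pi * Complex.I * (n : ℂ) *
            (Complex.I * ν / Real.pi * ((q : ℂ) / Real.sqrt 2 - z) + α)) := by
  have hπ : (Real.pi : ℂ) ≠ 0 := ofReal_ne_zero.mpr Real.pi_ne_zero
  have hs : ((Real.sqrt 2 : ℝ) : ℂ) ^ 2 = 2 := by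
    rw [← ofReal_pow, Real.sq_sqrt zero_le_two, ofReal_ofNat]
  have hs0 : ((Real.sqrt 2 : ℝ) : ℂ) ≠ 0 := by
    intro h
    simp [h] at hs
  have hdiv : (q : ℂ) / Real.sqrt 2 = q * Real.sqrt 2 / 2 := by
    rw [div_eq_div_iff hs0 two_ne_zero, mul_assoc, ← sq, hs]
  have hsq : Real.pi * Complex.I * (n : ℂ) ^ 2 * (Complex.I * ν / Real.pi) = -ν * n ^ 2 := by
    field_simp
    linear_combination (ν : ℂ) * n ^ 2 * I_sq
  have hlin : 2 * Real.pi * Complex.I * (n : ℂ) *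
      (Complex.I * ν / Real.pi * ((q : ℂ) * Real.sqrt 2 / 2 - z) + α) =
      -2 * ν * n * (q * Real.sqrt 2 / 2 - z) + 2 * Real.pi * Complex.I * α * n := by
    field_simp
    linear_combination (ν : ℂ) * n * (q * Real.sqrt 2 - 2 * z) * I_sq
  rw [← Complex.exp_add, ← Complex.exp_add, hdiv, hsq, hlin]
  congr 1
  push_cast
  linear_combination (ν * (q : ℂ) ^ 2 / 4 - ν * (n : ℂ) ^ 2 / 2 + ν * z * n) * hs

/-- For bounded measurable `φ` with `φ(q + √2 m) = e^{2πiαm} φ(q)` for a.e.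
`q ∈ ℝ` and every `m ∈ ℤ`, the Bargmann transform of `φ` is given by integration of `φ`
against the kernel `A(z;q)` over the period interval `[0, √2]`. -/
theorem stmt_13 (α ν : ℝ) (hν : 0 < ν) (φ : ℝ → ℂ) (hmeas : Measurable φ)
    (hbd : ∃ C : ℝ, ∀ q : ℝ, ‖φ q‖ ≤ C)
    (hqp : ∀ m : ℤ, ∀ᵐ q : ℝ, φ (q + Real.sqrt 2 * m) =
        Complex.exp (2 * Real.pi * Complex.I * α * m) * φ q) :
    ∀ z : ℂ,
      (((ν / Real.pi) ^ ((3 : ℝ) / 4) : ℝ) : ℂ) *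
          (∫ q : ℝ, φ q * Complex.exp (-(ν / 2) * (z ^ 2 + (q : ℂ) ^ 2) +
            ν * Real.sqrt 2 * z * q))
        = ∫ q in Set.Icc (0 : ℝ) (Real.sqrt 2), bargmannKernel α ν z q * φ q := by
  obtain ⟨C, hC⟩ := hbd
  intro z
  rw [integral_eq_setIntegral_tsum_add_mul_int (integrable_mul_bargmann_exp hν hmeas hC z)
    (Real.sqrt_pos.mpr two_pos), integral_Icc_eq_integral_Ioc, ← integral_const_mul]
  refine integral_congr_ae (ae_restrict_of_ae ?_)
  filter_upwards [ae_all_iff.mpr hqp] with q hq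
  have hterm (n : ℤ) := congrArg (φ q * ·) (bargmann_exp_add_sqrt_two_mul α ν z q n)
  simp only [← mul_assoc, mul_comm (φ q) (Complex.exp (2 * Real.pi * Complex.I * α * _))] at hterm
  simp only [hq, hterm, tsum_mul_left, bargmannKernel, jacobiTheta3]
  ring
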